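/- Let G be the Fibonacci numeration system, i.e., G_0 = 1, G_1 = 2 and G_{n+2} = G_{n+1} + G_n for n ≥ 0, and let β = (1+√5)/2 be the golden ratio. Then the Kakutani–Fibonacci sequence (φ_β(n))_{n≥1} (the golden-ratio van der Corput sequence built from Zeckendorf expansions, i.e., the LS-sequence with parameters L = S = 1) is uniformly distributed in [0,1). -/

import Mathlib

open MeasureTheory Filter

/-- `e` is the greedy `G`-expansion of the positive integer `n`. -/
def IsGExpansion (G : ℕ → ℕ) (n : ℕ) (e : ℕ → ℕ) : Prop :=
  (∃ K, (∀ k, K ≤ k → e k = 0) ∧ ∑ k ∈ Finset.range K, e k * G k = n) ∧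
  (∀ K, 1 ≤ K → ∑ k ∈ Finset.range K, e k * G k < G K)

/-- The `β`-adic Monna map applied to a digit sequence: `∑ k, e k / β^(k+1)`. -/
noncomputable def monna (β : ℝ) (e : ℕ → ℕ) : ℝ := ∑' k, (e k : ℝ) / β ^ (k + 1)

/-- A sequence `(x n)_{n ≥ 1}` is uniformly distributed in `[0,1)`. -/
def IsUDOne (x : ℕ → ℝ) : Prop :=
  ∀ a b : ℝ, 0 ≤ a → a ≤ b → b ≤ 1 →
    Tendsto (fun N : ℕ =>
        (∑ n ∈ Finset.Icc 1 N, Set.indicator (Set.Ico a b) (fun _ => (1 : ℝ)) (x n)) / (N : ℝ))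
      atTop (nhds (b - a))

/-- The golden-ratio Monna value of `n`, read off the Zeckendorf representation of `n`. -/
noncomputable def zeckendorfMonna (β : ℝ) (n : ℕ) : ℝ :=
  (n.zeckendorf.map fun i => 1 / β ^ (i - 1)).sum

/-- The number of `n < N` with `zeckendorfMonna β n < t`. -/
noncomputable def countBelow (β : ℝ) (N : ℕ) (t : ℝ) : ℝ :=
  ∑ n ∈ Finset.range N, if zeckendorfMonna β n < t then (1 : ℝ) else 0

/-- The truncation of a real number to `[0,1]`. -/
noncomputable def clampUnit (t : ℝ) : ℝ := max 0 (min t 1)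

lemma zeckendorfMonna_zero (β : ℝ) : zeckendorfMonna β 0 = 0 := by
  simp [zeckendorfMonna]

lemma zeckendorfMonna_fib_add (β : ℝ) (k r : ℕ) (hr : r < Nat.fib (k + 1)) :
    zeckendorfMonna β (Nat.fib (k + 2) + r) = 1 / β ^ (k + 1) + zeckendorfMonna β r := by
  have hpos : 0 < Nat.fib (k + 2) := Nat.fib_pos.2 (by omega)
  have hg : Nat.greatestFib (Nat.fib (k + 2) + r) = k + 2 := by
    apply le_antisymm
    · have : Nat.greatestFib (Nat.fib (k + 2) + r) < k + 3 := by
        rw [Nat.greatestFib_lt]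
        have := Nat.fib_add_two (n := k + 1)
        simp only [add_assoc, Nat.reduceAdd] at *
        omega
      omega
    · rw [Nat.le_greatestFib]
      omega
  rw [zeckendorfMonna, Nat.zeckendorf_of_pos (by omega), hg]
  simp [zeckendorfMonna]

lemma zeckendorfMonna_sum_digits (β : ℝ) (e : ℕ → ℕ)
    (he : ∀ K, 1 ≤ K → ∑ k ∈ Finset.range K, e k * Nat.fib (k + 2) < Nat.fib (K + 2)) (K : ℕ) :
    zeckendorfMonna β (∑ k ∈ Finset.range K, e k * Nat.fib (k + 2)) =
      ∑ k ∈ Finset.range K, (e k : ℝ) / β ^ (k + 1) := by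
  induction K with
  | zero => simp [zeckendorfMonna_zero]
  | succ K ih =>
    have h := he (K + 1) (by omega)
    have h1 := Nat.fib_add_two (n := K + 1)
    have h2 := Nat.fib_add_two (n := K)
    have h3 : Nat.fib (K + 1) ≤ Nat.fib (K + 2) := Nat.fib_le_fib_succ
    rw [Finset.sum_range_succ] at h ⊢
    rw [Finset.sum_range_succ]
    have hle : e K ≤ 1 := by
      by_contra hc
      have : 2 * Nat.fib (K + 2) ≤ e K * Nat.fib (K + 2) := Nat.mul_le_mul_right _ (by omega)
      simp only [add_assoc, Nat.reduceAdd] at *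
      omega
    interval_cases hk : e K
    · simp [ih]
    · rw [one_mul, add_comm, zeckendorfMonna_fib_add, ih]
      · push_cast
        ring
      · simp only [add_assoc, Nat.reduceAdd] at *
        omega

lemma monna_eq_zeckendorfMonna (β : ℝ) (n : ℕ) (e : ℕ → ℕ)
    (h : IsGExpansion (fun k => Nat.fib (k + 2)) n e) : monna β e = zeckendorfMonna β n := by
  obtain ⟨⟨K, hK, rfl⟩, he⟩ := h
  rw [zeckendorfMonna_sum_digits β e he K, monna, tsum_eq_sum]
  intro k hk
  simp [hK k (by simpa using hk)]

lemma countBelow_fib_add (β : ℝ) (k r : ℕ) (hr : r ≤ Nat.fib (k + 1)) (t : ℝ) :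
    countBelow β (Nat.fib (k + 2) + r) t =
      countBelow β (Nat.fib (k + 2)) t + countBelow β r (t - 1 / β ^ (k + 1)) := by
  rw [countBelow, Finset.sum_range_add, countBelow, countBelow]
  congr 1
  refine Finset.sum_congr rfl fun n hn => ?_
  rw [zeckendorfMonna_fib_add β k n (by simp at hn; omega)]
  simp only [lt_sub_iff_add_lt']

lemma countBelow_fib_add_three (β : ℝ) (k : ℕ) (t : ℝ) :
    countBelow β (Nat.fib (k + 3)) t =
      countBelow β (Nat.fib (k + 2)) t + countBelow β (Nat.fib (k + 1)) (t - 1 / β ^ (k + 1)) := by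
  rw [← countBelow_fib_add β k _ le_rfl, Nat.fib_add_two (n := k + 1), add_comm]

lemma countBelow_one (β t : ℝ) : countBelow β 1 t = if 0 < t then 1 else 0 := by
  rw [countBelow, Finset.sum_range_one, zeckendorfMonna_zero]

lemma countBelow_fib_self_similar {β : ℝ} (hβ : 0 < β) (k : ℕ) (t : ℝ) :
    countBelow β (Nat.fib (k + 3)) t =
      countBelow β (Nat.fib (k + 2)) (β * t) +
        countBelow β (Nat.fib (k + 1)) (β ^ 2 * t - β) := by
  have e1 : ∀ t, 0 < t - 1 / β ↔ 0 < β ^ 2 * t - β := fun t => by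
    rw [show β ^ 2 * t - β = β ^ 2 * (t - 1 / β) by field_simp,
      mul_pos_iff_of_pos_left (by positivity)]
  have e2 : ∀ t, 0 < t - 1 / β ^ 2 ↔ 0 < β * t - 1 / β := fun t => by
    rw [show β * t - 1 / β = β * (t - 1 / β ^ 2) by field_simp, mul_pos_iff_of_pos_left hβ]
  induction k using Nat.twoStepInduction generalizing t with
  | zero =>
    rw [countBelow_fib_add_three]
    simp only [zero_add, Nat.fib_one, Nat.fib_two, countBelow_one, pow_one, e1,
      mul_pos_iff_of_pos_left hβ]
  | one =>
    rw [countBelow_fib_add_three, countBelow_fib_add_three β 0, countBelow_fib_add_three β 0]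
    simp only [zero_add, Nat.reduceAdd, Nat.fib_one, Nat.fib_two, countBelow_one, pow_one, e1, e2,
      mul_pos_iff_of_pos_left hβ]
    ring
  | more k ih1 ih2 =>
    have f1 : β * (t - 1 / β ^ (k + 2 + 1)) = β * t - 1 / β ^ (k + 1 + 1) := by
      rw [pow_succ β (k + 2)]
      field_simp
    have f2 : β ^ 2 * (t - 1 / β ^ (k + 2 + 1)) - β = β ^ 2 * t - β - 1 / β ^ (k + 1) := by
      rw [show k + 2 + 1 = k + 1 + 2 by rfl, pow_add β (k + 1)]
      field_simp
      ring
    have h1 := ih1 (t - 1 / β ^ (k + 2 + 1))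
    rw [f1, f2] at h1
    have h2 := countBelow_fib_add_three β (k + 1) (β * t)
    have h3 := countBelow_fib_add_three β k (β ^ 2 * t - β)
    rw [countBelow_fib_add_three, ih2 t, h1, h2, h3]
    ring

lemma countBelow_fib_of_nonpos {β : ℝ} (hβ : 0 < β) (k : ℕ) (t : ℝ) (ht : t ≤ 0) :
    countBelow β (Nat.fib (k + 1)) t = 0 := by
  induction k using Nat.twoStepInduction generalizing t with
  | zero => simp [countBelow_one, ht]
  | one => simp [countBelow_one, ht]
  | more k ih1 ih2 =>
    rw [countBelow_fib_self_similar hβ, ih2 _ (by nlinarith), ih1 _ (by nlinarith [sq_nonneg β])]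
    simp

lemma countBelow_fib_of_one_le {β : ℝ} (hβ : 1 < β) (hsq : β ^ 2 = β + 1) (k : ℕ) (t : ℝ)
    (ht : 1 ≤ t) : countBelow β (Nat.fib (k + 1)) t = Nat.fib (k + 1) := by
  induction k using Nat.twoStepInduction generalizing t with
  | zero => simp [countBelow_one, zero_lt_one.trans_le ht]
  | one => simp [countBelow_one, zero_lt_one.trans_le ht]
  | more k ih1 ih2 =>
    rw [countBelow_fib_self_similar (by linarith), ih2 _ (by nlinarith),
      ih1 _ (by rw [hsq]; nlinarith), Nat.fib_add_two (n := k + 1)]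
    push_cast
    ring

lemma abs_fib_succ_sub_mul_fib_le {β : ℝ} (hβ : 1 < β) (hsq : β ^ 2 = β + 1) (k : ℕ) :
    |(Nat.fib (k + 2) : ℝ) - β * Nat.fib (k + 1)| ≤ 1 := by
  have hβ2 : β < 2 := by nlinarith
  induction k with
  | zero =>
    norm_num
    rw [abs_le]
    constructor <;> linarith
  | succ k ih =>
    have : (Nat.fib (k + 1 + 2) : ℝ) - β * Nat.fib (k + 1 + 1) =
        (1 - β) * ((Nat.fib (k + 2) : ℝ) - β * Nat.fib (k + 1)) := by
      rw [Nat.fib_add_two (n := k + 1)]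
      push_cast
      linear_combination (-(Nat.fib (k + 1) : ℝ)) * hsq
    rw [this, abs_mul]
    have h1 : |1 - β| ≤ 1 := by
      rw [abs_le]
      constructor <;> linarith
    exact mul_le_one₀ h1 (abs_nonneg _) ih

lemma clampUnit_of_nonpos {t : ℝ} (ht : t ≤ 0) : clampUnit t = 0 :=
  max_eq_left ((min_le_left _ _).trans ht)

lemma clampUnit_of_one_le {t : ℝ} (ht : 1 ≤ t) : clampUnit t = 1 := by
  simp [clampUnit, ht]

lemma clampUnit_of_mem {t : ℝ} (h0 : 0 ≤ t) (h1 : t ≤ 1) : clampUnit t = t := by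
  simp [clampUnit, h0, h1]

lemma clampUnit_mem (t : ℝ) : 0 ≤ clampUnit t ∧ clampUnit t ≤ 1 := by
  simp [clampUnit]

lemma clampUnit_sub (t d : ℝ) (hd : 0 ≤ d) : |clampUnit (t - d) - clampUnit t| ≤ d := by
  unfold clampUnit
  rw [abs_le]
  constructor <;> grind

lemma abs_countBelow_fib_sub_le {β : ℝ} (hβ : 1 < β) (hsq : β ^ 2 = β + 1) (k : ℕ) (t : ℝ) :
    |countBelow β (Nat.fib (k + 1)) t - Nat.fib (k + 1) * clampUnit t| ≤ k + 1 := by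
  have base : ∀ t, |countBelow β 1 t - 1 * clampUnit t| ≤ 1 := by
    intro t
    have := clampUnit_mem t
    rw [countBelow_one, abs_le]
    split_ifs <;> constructor <;> linarith
  induction k using Nat.twoStepInduction generalizing t with
  | zero => simpa using base t
  | one =>
    have := base t
    norm_num at this ⊢
    linarith
  | more k ih1 ih2 =>
    have hpos : 0 < β := by linarith
    have hd := abs_fib_succ_sub_mul_fib_le hβ hsq k
    have hf : (Nat.fib (k + 3) : ℝ) = Nat.fib (k + 1) + Nat.fib (k + 2) := by
      rw [Nat.fib_add_two (n := k + 1)]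
      push_cast
      ring
    have i1 := ih1 (β ^ 2 * t - β)
    have i2 := ih2 (β * t)
    change |countBelow β (Nat.fib (k + 3)) t - Nat.fib (k + 3) * clampUnit t| ≤ _
    change |countBelow β (Nat.fib (k + 2)) (β * t) - Nat.fib (k + 2) * clampUnit (β * t)| ≤ _ at i2
    push_cast at i2 ⊢
    rcases le_total t 0 with h0 | h0
    · rw [countBelow_fib_of_nonpos hpos _ _ h0, clampUnit_of_nonpos h0]
      simp
      positivity
    rcases le_total 1 t with h1 | h1
    · rw [countBelow_fib_of_one_le hβ hsq _ _ h1, clampUnit_of_one_le h1]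
      simp
      positivity
    rw [countBelow_fib_self_similar hpos, clampUnit_of_mem h0 h1]
    rw [abs_le] at hd i1 i2 ⊢
    rcases le_total (β * t) 1 with hb | hb
    · rw [countBelow_fib_of_nonpos hpos k (β ^ 2 * t - β) (by nlinarith), hf]
      rw [clampUnit_of_mem (by positivity) hb] at i2
      have key : (Nat.fib (k + 1) + Nat.fib (k + 2) : ℝ) * t - Nat.fib (k + 2) * (β * t) =
          -((β - 1) * t * ((Nat.fib (k + 2) : ℝ) - β * Nat.fib (k + 1))) := by
        linear_combination (-(Nat.fib (k + 1) : ℝ) * t) * hsq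
      have hc0 : 0 ≤ (β - 1) * t := mul_nonneg (by linarith) h0
      have hc1 : (β - 1) * t ≤ 1 := by nlinarith
      constructor <;> nlinarith
    · rw [countBelow_fib_of_one_le hβ hsq (k + 1) (β * t) hb, hf]
      rw [clampUnit_of_mem (by nlinarith) (by nlinarith)] at i1
      have key : (Nat.fib (k + 2) : ℝ) + Nat.fib (k + 1) * (β ^ 2 * t - β) -
          (Nat.fib (k + 1) + Nat.fib (k + 2)) * t =
          (1 - t) * ((Nat.fib (k + 2) : ℝ) - β * Nat.fib (k + 1)) := by
        linear_combination ((Nat.fib (k + 1) : ℝ) * t) * hsq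
      constructor <;> nlinarith

lemma fib_succ_le_pow {β : ℝ} (hβ : 1 < β) (hsq : β ^ 2 = β + 1) (k : ℕ) :
    (Nat.fib (k + 1) : ℝ) ≤ β ^ k := by
  induction k using Nat.twoStepInduction with
  | zero => simp
  | one => simpa using hβ.le
  | more k ih1 ih2 =>
    rw [Nat.fib_add_two, pow_add, hsq]
    push_cast
    have : β ^ (k + 1) = β ^ k * β := pow_succ _ _
    linarith

lemma pow_le_fib_add_two {β : ℝ} (hβ : 1 < β) (hsq : β ^ 2 = β + 1) (k : ℕ) :
    β ^ k ≤ Nat.fib (k + 2) := by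
  have hβ2 : β < 2 := by nlinarith
  induction k using Nat.twoStepInduction with
  | zero => simp
  | one =>
    norm_num [Nat.fib_add_two]
    exact hβ2.le
  | more k ih1 ih2 =>
    rw [Nat.fib_add_two (n := k + 2), pow_add, hsq]
    push_cast
    have : β ^ (k + 1) = β ^ k * β := pow_succ _ _
    linarith

lemma abs_countBelow_sub_le {β : ℝ} (hβ : 1 < β) (hsq : β ^ 2 = β + 1) (k N : ℕ)
    (hN : N ≤ Nat.fib (k + 1)) (t : ℝ) :
    |countBelow β N t - N * clampUnit t| ≤ ((k : ℝ) + 1) ^ 2 := by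
  have base : ∀ N ≤ 1, ∀ t, |countBelow β N t - N * clampUnit t| ≤ 1 := by
    intro N hN t
    interval_cases N
    · simp [countBelow]
    · simpa using abs_countBelow_fib_sub_le hβ hsq 0 t
  induction k using Nat.twoStepInduction generalizing N t with
  | zero => simpa using base N (by simpa using hN) t
  | one =>
    have := base N (by simpa using hN) t
    norm_num
    linarith
  | more k ih1 ih2 =>
    push_cast at ih2 ⊢
    rcases le_total N (Nat.fib (k + 2)) with h | h
    · exact (ih2 N h t).trans (by gcongr; norm_num)
    obtain ⟨r, rfl⟩ := Nat.exists_eq_add_of_le h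
    have hr : r ≤ Nat.fib (k + 1) := by
      have := Nat.fib_add_two (n := k + 1)
      simp only [add_assoc, Nat.reduceAdd] at *
      omega
    have hpos : 0 < β := by linarith
    have h1 := abs_countBelow_fib_sub_le hβ hsq (k + 1) t
    have h2 := ih1 r hr (t - 1 / β ^ (k + 1))
    have h3 : |(r : ℝ) * (clampUnit (t - 1 / β ^ (k + 1)) - clampUnit t)| ≤ 1 := by
      rw [abs_mul, Nat.abs_cast]
      calc (r : ℝ) * |clampUnit (t - 1 / β ^ (k + 1)) - clampUnit t|
          ≤ β ^ (k + 1) * (1 / β ^ (k + 1)) := by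
            gcongr
            · calc (r : ℝ) ≤ Nat.fib (k + 1) := by exact_mod_cast hr
                _ ≤ β ^ k := fib_succ_le_pow hβ hsq k
                _ ≤ β ^ (k + 1) := pow_le_pow_right₀ hβ.le (by omega)
            · exact clampUnit_sub _ _ (by positivity)
        _ = 1 := by field_simp
    rw [countBelow_fib_add β k r hr]
    push_cast at h1 ⊢
    rw [abs_le] at *
    have hk : (0 : ℝ) ≤ k := by positivity
    constructor <;> nlinarith

lemma tendsto_greatestFib_atTop : Tendsto Nat.greatestFib atTop atTop :=
  tendsto_atTop.2 fun b => (eventually_ge_atTop (Nat.fib b)).mono fun _ h => Nat.le_greatestFib.2 h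

lemma tendsto_sq_greatestFib_div {β : ℝ} (hβ : 1 < β) (hsq : β ^ 2 = β + 1) :
    Tendsto (fun N : ℕ => ((Nat.greatestFib N : ℝ) + 1) ^ 2 / N) atTop (nhds 0) := by
  have h := ((tendsto_pow_const_div_const_pow_of_one_lt 2 hβ).comp
    ((tendsto_add_atTop_nat 1).comp tendsto_greatestFib_atTop)).const_mul (β ^ 3)
  rw [mul_zero] at h
  refine squeeze_zero' (Eventually.of_forall fun N => by positivity) ?_ h
  filter_upwards [eventually_ge_atTop 1] with N hN
  have hg : 2 ≤ Nat.greatestFib N := Nat.le_greatestFib.2 (by simpa using hN)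
  obtain ⟨g, hgg⟩ := Nat.exists_eq_add_of_le' hg
  have hfib : (Nat.fib (g + 2) : ℝ) ≤ N := by
    exact_mod_cast hgg ▸ Nat.fib_greatestFib_le N
  have hpos : 0 < β := by linarith
  simp only [Function.comp_apply, hgg]
  calc (((g + 2 : ℕ) : ℝ) + 1) ^ 2 / N ≤ (((g + 2 : ℕ) : ℝ) + 1) ^ 2 / β ^ g := by
        gcongr
        exact (pow_le_fib_add_two hβ hsq g).trans hfib
    _ = β ^ 3 * (((g + 2 + 1 : ℕ) : ℝ) ^ 2 / β ^ (g + 2 + 1)) := by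
        push_cast
        rw [show g + 2 + 1 = g + 3 by rfl, pow_add]
        field_simp

lemma sum_indicator_Ico_eq_countBelow_sub (β : ℝ) {a b : ℝ} (hab : a ≤ b) (N : ℕ) :
    ∑ n ∈ Finset.range N, Set.indicator (Set.Ico a b) (fun _ => (1 : ℝ)) (zeckendorfMonna β n) =
      countBelow β N b - countBelow β N a := by
  rw [countBelow, countBelow, ← Finset.sum_sub_distrib]
  refine Finset.sum_congr rfl fun n _ => ?_
  simp only [Set.indicator_apply, Set.mem_Ico]
  grind

lemma abs_sum_Icc_indicator_sub_le {β : ℝ} (hβ : 1 < β) (hsq : β ^ 2 = β + 1) {a b : ℝ}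
    (ha : 0 ≤ a) (hab : a ≤ b) (hb : b ≤ 1) (N : ℕ) :
    |∑ n ∈ Finset.Icc 1 N,
        Set.indicator (Set.Ico a b) (fun _ => (1 : ℝ)) (zeckendorfMonna β n) - N * (b - a)| ≤
      3 * ((Nat.greatestFib N : ℝ) + 1) ^ 2 := by
  set f : ℕ → ℝ := fun n =>
    Set.indicator (Set.Ico a b) (fun _ => (1 : ℝ)) (zeckendorfMonna β n) with hf
  have hf01 : ∀ n, 0 ≤ f n ∧ f n ≤ 1 := by
    intro n
    simp only [hf, Set.indicator_apply]
    split_ifs <;> norm_num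
  have hsum : ∑ n ∈ Finset.Icc 1 N, f n + f 0 = ∑ n ∈ Finset.range N, f n + f N := by
    rw [← Finset.sum_range_succ, Finset.sum_range_succ']
    congr 1
    rw [Finset.range_eq_Ico, Finset.sum_Ico_add' f 0 N 1]
    rfl
  have hN : N ≤ Nat.fib (Nat.greatestFib N + 1) := (Nat.lt_fib_greatestFib_add_one N).le
  have hA := abs_countBelow_sub_le hβ hsq _ N hN a
  have hB := abs_countBelow_sub_le hβ hsq _ N hN b
  rw [clampUnit_of_mem ha (hab.trans hb)] at hA
  rw [clampUnit_of_mem (ha.trans hab) hb] at hB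
  have hc := sum_indicator_Ico_eq_countBelow_sub β hab N
  have h0 := hf01 0
  have h1 := hf01 N
  have hg : (1 : ℝ) ≤ ((Nat.greatestFib N : ℝ) + 1) ^ 2 :=
    one_le_pow₀ (by linarith [Nat.cast_nonneg (α := ℝ) (Nat.greatestFib N)])
  rw [abs_le] at *
  constructor <;> linarith

/-- The Kakutani–Fibonacci sequence (the golden-ratio van der Corput sequence
built from Zeckendorf expansions in the system G₀ = 1, G₁ = 2,
G_{n+2} = G_{n+1} + G_n) is uniformly distributed in [0,1). -/
theorem kakutani_fibonacci_sequence_ud (G : ℕ → ℕ)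
    (hG : G 0 = 1 ∧ G 1 = 2 ∧ ∀ n, G (n + 2) = G (n + 1) + G n)
    (β : ℝ) (hβ : β = (1 + Real.sqrt 5) / 2)
    (ε : ℕ → ℕ → ℕ) (hε : ∀ n, 1 ≤ n → IsGExpansion G n (ε n)) :
    IsUDOne (fun n => monna β (ε n)) := by
  have hGfib : G = fun k => Nat.fib (k + 2) := by
    funext k
    induction k using Nat.twoStepInduction with
    | zero => simp [hG.1]
    | one => simp [hG.2.1, Nat.fib_add_two]
    | more k ih1 ih2 => rw [hG.2.2, ih1, ih2, Nat.fib_add_two (n := k + 2), add_comm]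
  subst hGfib
  have hβ1 : 1 < β := hβ ▸ Real.one_lt_goldenRatio
  have hsq : β ^ 2 = β + 1 := hβ ▸ Real.goldenRatio_sq
  intro a b ha hab hb
  rw [tendsto_iff_norm_sub_tendsto_zero]
  have h := (tendsto_sq_greatestFib_div hβ1 hsq).const_mul 3
  rw [mul_zero] at h
  refine squeeze_zero' (Eventually.of_forall fun N => norm_nonneg _) ?_ h
  filter_upwards [eventually_ge_atTop 1] with N hN
  have hN0 : (0 : ℝ) < N := by exact_mod_cast hN
  have hcongr : ∀ n ∈ Finset.Icc 1 N,
      Set.indicator (Set.Ico a b) (fun _ => (1 : ℝ)) (monna β (ε n)) =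
        Set.indicator (Set.Ico a b) (fun _ => (1 : ℝ)) (zeckendorfMonna β n) := fun n hn => by
    rw [monna_eq_zeckendorfMonna β n (ε n) (hε n (Finset.mem_Icc.1 hn).1)]
  rw [Finset.sum_congr rfl hcongr, Real.norm_eq_abs, div_sub' hN0.ne', abs_div, Nat.abs_cast,
    ← mul_div_assoc]
  gcongr
  exact abs_sum_Icc_indicator_sub_le hβ1 hsq ha hab hb N
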